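/- Let X be a nonempty open convex subset of ℝⁿ, let h₁,…,h_p : X → ℝ be upper semicontinuous and quasiconcave, and let F = {x ∈ X : h_j(x) ≥ 0 for all j = 1,…,p} be the feasible set. Let x̄ ∈ F and let j be an index with h_j(x̄) = 0. Assume that 0 ∉ ∂̂^{D+}h_j(x) for every x ∈ F with h_j(x) = 0. Then for every x ∈ F and every x̄* ∈ ∂̂^{D+}h_j(x̄), one has ⟨x̄*, x − x̄⟩ ≥ 0. -/

import Mathlib

open RealInnerProductSpace

/-- The upper-Dini superdifferential of `h` at `x`. -/
def upperDiniSuper {n : ℕ} (h : EuclideanSpace ℝ (Fin n) → ℝ)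
    (x : EuclideanSpace ℝ (Fin n)) : Set (EuclideanSpace ℝ (Fin n)) :=
  {xs | ∀ v : EuclideanSpace ℝ (Fin n),
    Filter.liminf (fun t : ℝ => (h (x + t • v) - h x) / t) (nhdsWithin 0 (Set.Ioi 0)) ≤ ⟪xs, v⟫}

/-- The real-valued `liminf` of an eventually nonnegative function is nonnegative, even when it is
not bounded: the default value is then `0`. -/
theorem Real.liminf_nonneg_of_eventually {α : Type*} {l : Filter α} {f : α → ℝ}
    (hf : ∀ᶠ t in l, 0 ≤ f t) : 0 ≤ Filter.liminf f l := by
  rw [Filter.liminf_eq]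
  by_cases hb : BddAbove {a : ℝ | ∀ᶠ t in l, a ≤ f t}
  · exact le_csSup hb hf
  · rw [Real.sSup_of_not_bddAbove hb]

theorem stmt_18 {n : ℕ} {p : ℕ} (X : Set (EuclideanSpace ℝ (Fin n)))
    (h : Fin p → EuclideanSpace ℝ (Fin n) → ℝ)
    (hne : X.Nonempty) (hopen : IsOpen X) (hconv : Convex ℝ X)
    (husc : ∀ j, UpperSemicontinuousOn (h j) X)
    (hqc : ∀ j, QuasiconcaveOn ℝ X (h j))
    (F : Set (EuclideanSpace ℝ (Fin n)))
    (hFdef : F = {x ∈ X | ∀ j, 0 ≤ h j x})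
    (xbar : EuclideanSpace ℝ (Fin n)) (hxbar : xbar ∈ F)
    (j : Fin p) (hj : h j xbar = 0)
    (h0 : ∀ x ∈ F, h j x = 0 → 0 ∉ upperDiniSuper (h j) x) :
    ∀ x ∈ F, ∀ xs ∈ upperDiniSuper (h j) xbar, 0 ≤ ⟪xs, x - xbar⟫ := by
  intro x hx xs hxs
  subst hFdef
  refine le_trans (Real.liminf_nonneg_of_eventually ?_) (hxs (x - xbar))
  filter_upwards [Ioo_mem_nhdsGT (zero_lt_one' ℝ)] with t ht
  have hmem := (hqc j 0).add_smul_sub_mem ⟨hxbar.1, hxbar.2 j⟩ ⟨hx.1, hx.2 j⟩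
    ⟨ht.1.le, ht.2.le⟩
  rw [hj, sub_zero]
  exact div_nonneg hmem.2 ht.1.le
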